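/- Let d = 1, let ρ0 be the Gaussian density with mean 0 and variance 1, let ρ1 be the Gaussian density with mean m ∈ ℝ and variance 1, and let I_t(x0,x1) = cos(πt/2) x0 + sin(πt/2) x1. Then: (i) the interpolant density ρ_t is the Gaussian density with mean m sin(πt/2) and variance 1; (ii) the velocity field is constant in x, v_t(x) = (π/2) m cos(πt/2), so that ∫_ℝ |v_t(x)|² ρ_t(x) dx = (π²/4) m² cos²(πt/2); and (iii) E[|v_t(I_t(x0,x1))|²] = E[|∂_t I_t(x0,x1)|²] − π²/4 < E[|∂_t I_t(x0,x1)|²], so the inequality E[|v_t(I_t)|²] ≤ E[|∂_t I_t|²] is not saturated. -/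

import Mathlib

open MeasureTheory Real Set
open scoped ENNReal

/-- The measure on `ℝ` with Lebesgue density `ρ`. -/
noncomputable def densMeasure1 (ρ : ℝ → ℝ) : Measure ℝ :=
  volume.withDensity fun x => ENNReal.ofReal (ρ x)

/-- The one-dimensional Gaussian density with mean `m` and unit variance. -/
noncomputable def gauss1 (m x : ℝ) : ℝ :=
  (2 * π) ^ (-(1 : ℝ) / 2) * Real.exp (-(x - m) ^ 2 / 2)

open ProbabilityTheory

lemma gauss1_eq_gaussianPDFReal (m : ℝ) : gauss1 m = gaussianPDFReal m 1 := by
  ext x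
  have h : (2 * π) ^ (-(1 : ℝ) / 2) = (√(2 * π))⁻¹ := by
    rw [Real.sqrt_eq_rpow, ← Real.rpow_neg (by positivity)]
    norm_num
  simp [gauss1, gaussianPDFReal, h]

lemma continuous_gauss1 (m : ℝ) : Continuous (gauss1 m) := by
  unfold gauss1
  fun_prop

lemma measurable_ofReal_gauss1 (m : ℝ) : Measurable fun x => ENNReal.ofReal (gauss1 m x) :=
  (continuous_gauss1 m).measurable.ennreal_ofReal

lemma gauss1_pos (m x : ℝ) : 0 < gauss1 m x := by
  unfold gauss1
  positivity

lemma densMeasure1_gauss1 (m : ℝ) : densMeasure1 (gauss1 m) = gaussianReal m 1 := by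
  rw [gaussianReal_of_var_ne_zero m one_ne_zero, densMeasure1, gauss1_eq_gaussianPDFReal]
  rfl

/-- A continuous density of a unit-variance Gaussian measure is the Gaussian density. -/
lemma eq_gauss1_of_densMeasure1_eq {ρ : ℝ → ℝ} (hρ : Continuous ρ) {m : ℝ}
    (h : densMeasure1 ρ = gaussianReal m 1) (x : ℝ) : ρ x = gauss1 m x := by
  rw [← densMeasure1_gauss1, densMeasure1, densMeasure1, withDensity_eq_iff_of_sigmaFinite
    (by fun_prop) (measurable_ofReal_gauss1 m).aemeasurable] at h
  have hx := congrFun (Measure.eq_of_ae_eq h (ENNReal.continuous_ofReal.comp hρ)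
    (ENNReal.continuous_ofReal.comp (continuous_gauss1 m))) x
  have hpos : 0 < ρ x := by
    have := ENNReal.ofReal_pos.2 (gauss1_pos m x)
    rwa [← hx, ENNReal.ofReal_pos] at this
  exact (ENNReal.ofReal_eq_ofReal_iff hpos.le (gauss1_pos m x).le).1 hx

/-- Plane rotations preserve Lebesgue measure. -/
lemma measurePreserving_rotation {c s : ℝ} (hcs : c ^ 2 + s ^ 2 = 1) :
    MeasurePreserving (fun p : ℝ × ℝ => (c * p.1 + s * p.2, -s * p.1 + c * p.2)) := by
  set L := Matrix.toLin (.finTwoProd ℝ) (.finTwoProd ℝ) !![c, s; -s, c] with hL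
  have hdet : LinearMap.det L = 1 := by
    rw [hL, LinearMap.det_toLin, Matrix.det_fin_two_of]
    linarith
  have hfun : (fun p : ℝ × ℝ => (c * p.1 + s * p.2, -s * p.1 + c * p.2)) = L := by
    ext p <;> simp [hL, Matrix.toLin_finTwoProd_apply]
  refine ⟨by fun_prop, ?_⟩
  rw [hfun, Measure.map_linearMap_addHaar_eq_smul_addHaar volume (by simp [hdet]), hdet]
  simp

lemma gauss1_mul_gauss1_rotation {c s : ℝ} (hcs : c ^ 2 + s ^ 2 = 1) (m x y : ℝ) :
    gauss1 (m * s) (c * x + s * y) * gauss1 (m * c) (-s * x + c * y) =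
      gauss1 0 x * gauss1 m y := by
  unfold gauss1
  rw [mul_mul_mul_comm, mul_mul_mul_comm _ (rexp (-(x - 0) ^ 2 / 2)), ← Real.exp_add,
    ← Real.exp_add]
  congr 2
  linear_combination (-(x ^ 2 + (y - m) ^ 2) / 2) * hcs

/-- A plane rotation maps a product of unit-variance Gaussians to such a product, with the
mean rotated accordingly. -/
lemma measurePreserving_rotation_gaussianReal {c s : ℝ} (hcs : c ^ 2 + s ^ 2 = 1) (m : ℝ) :
    MeasurePreserving (fun p : ℝ × ℝ => (c * p.1 + s * p.2, -s * p.1 + c * p.2))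
      ((gaussianReal 0 1).prod (gaussianReal m 1))
      ((gaussianReal (m * s) 1).prod (gaussianReal (m * c) 1)) := by
  have hprod (a b : ℝ) : (gaussianReal a 1).prod (gaussianReal b 1) =
      (volume : Measure (ℝ × ℝ)).withDensity
        fun p => ENNReal.ofReal (gauss1 a p.1) * ENNReal.ofReal (gauss1 b p.2) := by
    rw [← densMeasure1_gauss1, ← densMeasure1_gauss1, densMeasure1, densMeasure1,
      prod_withDensity (measurable_ofReal_gauss1 a) (measurable_ofReal_gauss1 b)]
    rfl
  have hmeas (a b : ℝ) : Measurable fun p : ℝ × ℝ =>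
      ENNReal.ofReal (gauss1 a p.1) * ENNReal.ofReal (gauss1 b p.2) :=
    ((measurable_ofReal_gauss1 a).comp measurable_fst).mul
      ((measurable_ofReal_gauss1 b).comp measurable_snd)
  refine ⟨by fun_prop, Measure.ext fun A hA => ?_⟩
  rw [Measure.map_apply (by fun_prop) hA, hprod, hprod, withDensity_apply _ hA,
    withDensity_apply _ (hA.preimage (by fun_prop)),
    ← (measurePreserving_rotation hcs).setLIntegral_comp_preimage hA (hmeas _ _)]
  refine lintegral_congr fun p => ?_
  rw [← ENNReal.ofReal_mul (gauss1_pos _ _).le, ← ENNReal.ofReal_mul (gauss1_pos _ _).le,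
    gauss1_mul_gauss1_rotation hcs]

lemma integral_mul_gauss1 (m : ℝ) (f : ℝ → ℝ) :
    ∫ x, f x * gauss1 m x = ∫ x, f x ∂gaussianReal m 1 := by
  rw [integral_gaussianReal_eq_integral_smul one_ne_zero, gauss1_eq_gaussianPDFReal]
  simp_rw [smul_eq_mul, mul_comm]

lemma integral_integral_mul_gauss1 (a b : ℝ) (f : ℝ → ℝ → ℝ) :
    ∫ x, ∫ y, f x y * (gauss1 a x * gauss1 b y) =
      ∫ x, ∫ y, f x y ∂gaussianReal b 1 ∂gaussianReal a 1 := by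
  rw [← integral_mul_gauss1]
  refine integral_congr_ae (.of_forall fun x => ?_)
  simp only
  rw [← integral_mul_gauss1, ← integral_mul_const]
  exact integral_congr_ae (.of_forall fun y => by ring)

/-- Separation of variables in rotated coordinates for a product of Gaussians. -/
lemma integral_integral_rotation {c s : ℝ} (hcs : c ^ 2 + s ^ 2 = 1) (m : ℝ) {f g : ℝ → ℝ}
    (hf : Integrable f (gaussianReal (m * s) 1)) (hg : Integrable g (gaussianReal (m * c) 1)) :
    ∫ x, ∫ y, f (c * x + s * y) * g (-s * x + c * y) * (gauss1 0 x * gauss1 m y) =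
      (∫ x, f x ∂gaussianReal (m * s) 1) * ∫ x, g x ∂gaussianReal (m * c) 1 := by
  have hR := measurePreserving_rotation_gaussianReal hcs m
  have hfg := hf.mul_prod hg
  rw [integral_integral_mul_gauss1 0 m
    fun x y => f (c * x + s * y) * g (-s * x + c * y), ← integral_prod_mul,
    integral_integral (f := fun x y => f (c * x + s * y) * g (-s * x + c * y))
      (hR.integrable_comp_of_integrable hfg), ← hR.map_eq,
    integral_map hR.aemeasurable (hR.map_eq ▸ hfg.aestronglyMeasurable)]

lemma integral_sq_gaussianReal (m : ℝ) : ∫ x, x ^ 2 ∂gaussianReal m 1 = 1 + m ^ 2 := by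
  have h := variance_eq_sub (memLp_id_gaussianReal (μ := m) (v := 1) 2)
  rw [variance_id_gaussianReal] at h
  simp only [Pi.pow_apply, id_eq, integral_id_gaussianReal, NNReal.coe_one] at h
  linarith

lemma integrable_sq_gaussianReal (m : ℝ) : Integrable (fun x => x ^ 2) (gaussianReal m 1) :=
  (memLp_id_gaussianReal (μ := m) (v := 1) 2).integrable_sq

/-- In dimension one, with `ρ0 = N(0,1)`, `ρ1 = N(m,1)` and the
trigonometric interpolant: (i) `ρ_t = N(m sin(πt/2), 1)`; (ii) the velocity is constant in
`x`, `v_t(x) = (π/2) m cos(πt/2)`, so `∫ |v_t|² ρ_t = (π²/4) m² cos²(πt/2)`; and (iii)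
`E[|v_t(I_t)|²] = E[|∂_t I_t|²] - π²/4 < E[|∂_t I_t|²]`: the bound is not saturated. -/
theorem gaussian_example_not_saturated
    (m : ℝ) (ρ0 ρ1 : ℝ → ℝ)
    (hρ0 : ∀ x, ρ0 x = gauss1 0 x) (hρ1 : ∀ x, ρ1 x = gauss1 m x)
    -- the trigonometric interpolant and its time derivative
    (I : ℝ → ℝ → ℝ → ℝ)
    (hI : ∀ t x0 x1, I t x0 x1 = Real.cos (π * t / 2) * x0 + Real.sin (π * t / 2) * x1)
    (dI : ℝ → ℝ → ℝ → ℝ)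
    (hdI : ∀ t x0 x1, dI t x0 x1 =
      -(π / 2) * Real.sin (π * t / 2) * x0 + π / 2 * Real.cos (π * t / 2) * x1)
    -- `ρ_t` is the (continuous) probability density of `x_t = I_t(x0,x1)`
    (ρt : ℝ → ℝ → ℝ)
    (hρt : ∀ t ∈ Icc (0:ℝ) 1,
      Measure.map (fun p : ℝ × ℝ => I t p.1 p.2)
        ((densMeasure1 ρ0).prod (densMeasure1 ρ1)) = densMeasure1 (ρt t))
    (hρtC : ∀ t ∈ Icc (0:ℝ) 1, Continuous (ρt t))
    -- the (continuous) probability current, defined weakly against test functions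
    (j : ℝ → ℝ → ℝ)
    (hj : ∀ t ∈ Icc (0:ℝ) 1, ∀ φ : ℝ → ℝ, Continuous φ → HasCompactSupport φ →
      ∫ x, φ x * j t x = ∫ x0, ∫ x1, φ (I t x0 x1) * dI t x0 x1 * (ρ0 x0 * ρ1 x1))
    (hjC : ∀ t ∈ Icc (0:ℝ) 1, Continuous (j t))
    -- the velocity field `v = j/ρ` on `{ρ > 0}`, zero elsewhere
    (v : ℝ → ℝ → ℝ)
    (hv : ∀ t x, v t x = if 0 < ρt t x then j t x / ρt t x else 0) :
    -- (i) the interpolant density is a unit-variance Gaussian with mean `m sin(πt/2)`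
    (∀ t ∈ Icc (0:ℝ) 1, ∀ x, ρt t x = gauss1 (m * Real.sin (π * t / 2)) x) ∧
    -- (ii) the velocity is constant in `x`
    (∀ t ∈ Icc (0:ℝ) 1, (∀ x, v t x = π / 2 * m * Real.cos (π * t / 2)) ∧
      ∫ x, |v t x| ^ 2 * ρt t x = π ^ 2 / 4 * m ^ 2 * Real.cos (π * t / 2) ^ 2) ∧
    -- (iii) the second-moment inequality is not saturated
    (∫ t in Icc (0:ℝ) 1, ∫ x0, ∫ x1, |v t (I t x0 x1)| ^ 2 * (ρ0 x0 * ρ1 x1)) =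
      (∫ t in Icc (0:ℝ) 1, ∫ x0, ∫ x1, |dI t x0 x1| ^ 2 * (ρ0 x0 * ρ1 x1)) - π ^ 2 / 4 ∧
    (∫ t in Icc (0:ℝ) 1, ∫ x0, ∫ x1, |v t (I t x0 x1)| ^ 2 * (ρ0 x0 * ρ1 x1)) <
      ∫ t in Icc (0:ℝ) 1, ∫ x0, ∫ x1, |dI t x0 x1| ^ 2 * (ρ0 x0 * ρ1 x1) := by
  have hcs (t : ℝ) : cos (π * t / 2) ^ 2 + sin (π * t / 2) ^ 2 = 1 := cos_sq_add_sin_sq _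
  have hρ0' : ρ0 = gauss1 0 := funext hρ0
  have hρ1' : ρ1 = gauss1 m := funext hρ1
  have hdI' (t x0 x1 : ℝ) : dI t x0 x1 =
      π / 2 * (-sin (π * t / 2) * x0 + cos (π * t / 2) * x1) := by
    rw [hdI]
    ring
  subst hρ0' hρ1'
  have density : ∀ t ∈ Icc (0:ℝ) 1, ∀ x, ρt t x = gauss1 (m * sin (π * t / 2)) x := by
    intro t ht
    refine eq_gauss1_of_densMeasure1_eq (hρtC t ht) ?_
    have hR := measurePreserving_rotation_gaussianReal (hcs t) m
    have h := (measurePreserving_fst.comp hR).map_eq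
    rw [← hρt t ht, densMeasure1_gauss1, densMeasure1_gauss1, ← h]
    simp_rw [hI]
    rfl
  have current : ∀ t ∈ Icc (0:ℝ) 1, ∀ x,
      j t x = π / 2 * m * cos (π * t / 2) * gauss1 (m * sin (π * t / 2)) x := by
    intro t ht
    have hC : Continuous fun x =>
        π / 2 * m * cos (π * t / 2) * gauss1 (m * sin (π * t / 2)) x :=
      continuous_const.mul (continuous_gauss1 _)
    refine congrFun (Measure.eq_of_ae_eq (μ := volume) ?_ (hjC t ht) hC)
    refine ae_eq_of_integral_contDiff_smul_eq (hjC t ht).locallyIntegrable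
      hC.locallyIntegrable fun φ hφ hφc => ?_
    have hφi : Integrable φ (gaussianReal (m * sin (π * t / 2)) 1) :=
      hφ.continuous.integrable_of_hasCompactSupport hφc
    have hgi : Integrable (fun x => π / 2 * x) (gaussianReal (m * cos (π * t / 2)) 1) :=
      ((memLp_id_gaussianReal 1).integrable le_rfl).const_mul _
    simp only [smul_eq_mul]
    rw [hj t ht φ hφ.continuous hφc]
    simp_rw [hI, hdI']
    rw [integral_integral_rotation (hcs t) m hφi hgi, integral_const_mul,
      integral_id_gaussianReal, ← integral_mul_gauss1, ← integral_mul_const]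
    exact integral_congr_ae (.of_forall fun x => by ring)
  have velocity : ∀ t ∈ Icc (0:ℝ) 1, ∀ x, v t x = π / 2 * m * cos (π * t / 2) := by
    intro t ht x
    have hpos := gauss1_pos (m * sin (π * t / 2)) x
    rw [hv, density t ht, current t ht, if_pos hpos, mul_div_cancel_right₀ _ hpos.ne']
  have hvE : ∀ t ∈ Icc (0:ℝ) 1,
      ∫ x0, ∫ x1, |v t (I t x0 x1)| ^ 2 * (gauss1 0 x0 * gauss1 m x1) =
        (π / 2 * m * cos (π * t / 2)) ^ 2 := by
    intro t ht
    simp_rw [velocity t ht, sq_abs]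
    rw [integral_integral_mul_gauss1 0 m fun _ _ => (π / 2 * m * cos (π * t / 2)) ^ 2]
    simp
  have hdE : ∀ t,
      ∫ x0, ∫ x1, |dI t x0 x1| ^ 2 * (gauss1 0 x0 * gauss1 m x1) =
        (π / 2 * m * cos (π * t / 2)) ^ 2 + π ^ 2 / 4 := by
    intro t
    have h := integral_integral_rotation (hcs t) m (integrable_const (1 : ℝ))
      ((integrable_sq_gaussianReal _).const_mul (π ^ 2 / 4))
    simp_rw [hdI', sq_abs, mul_pow, div_pow]
    norm_num [integral_const_mul, integral_sq_gaussianReal] at h ⊢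
    rw [h]
    ring
  have main : (∫ t in Icc (0:ℝ) 1, ∫ x0, ∫ x1,
        |v t (I t x0 x1)| ^ 2 * (gauss1 0 x0 * gauss1 m x1)) =
      (∫ t in Icc (0:ℝ) 1, ∫ x0, ∫ x1,
        |dI t x0 x1| ^ 2 * (gauss1 0 x0 * gauss1 m x1)) - π ^ 2 / 4 := by
    rw [setIntegral_congr_fun measurableSet_Icc hvE]
    simp_rw [hdE]
    rw [integral_add (Continuous.integrableOn_Icc (by fun_prop)) (by simp)]
    simp
  refine ⟨density, fun t ht => ⟨velocity t ht, ?_⟩, main, ?_⟩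
  · simp_rw [velocity t ht, density t ht, sq_abs]
    rw [integral_mul_gauss1 _ fun _ => (π / 2 * m * cos (π * t / 2)) ^ 2]
    simp only [integral_const, probReal_univ, smul_eq_mul]
    ring
  · rw [main]
    exact sub_lt_self _ (by positivity)
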